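/- arXiv:1304.3314 — 5 statements merged into one kernel-verified Lean document; each statement's English description precedes it below -/
import Mathlib

section
/- Let S and A be metrizable topological spaces equipped with their Borel σ-algebras, with A compact. Let q : S × A → ℝ be continuous and nonnegative, let κ be a kernel from S × A to S with total mass κ(x,a)(S) = q(x,a) for every (x,a), and assume that for every bounded continuous f : S → ℝ the map (x,a) ↦ (∫ f dκ(x,a)) / q(x,a) (with the convention 0/0 := 0) is continuous on S × A. Let c : S × A → [0,∞] be lower semicontinuous, and let η be a Borel measure on S × A such that ∫ c dη < ∞ and such that for every Borel set Γ ⊆ S one has ∫_{S×A} κ(x,a)(Γ) η(d(x,a)) ≤ 1 + ∫_{Γ×A} q(x,a) η(d(x,a)). Suppose (B_j)_{j≥1} is an increasing sequence of open subsets of S satisfying ∫_{B_j×A} q(x,a) η(d(x,a)) < ∞ for every j. Then, setting Y := {x ∈ S : for all a ∈ A, κ(x,a)(⋃_j B_j) + c(x,a) > 0}, there exists a sequence (E_j)_{j≥1} of open subsets of S such that Y = ⋃_j E_j and ∫_{E_j×A} q(x,a) η(d(x,a)) < ∞ for every j. -/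
open MeasureTheory ProbabilityTheory Set
open scoped ENNReal

/-- Abstract form of Lemma 4.3(a): existence of open sets `E j` covering
`Y = {x | ∀ a, κ(x,a)(⋃ j, B j) + c(x,a) > 0}`, each of finite measure with respect to
`∫_{· × A} q dη`. -/
theorem exists_open_cover_finite_q_integral
    {S A : Type*}
    [TopologicalSpace S] [MeasurableSpace S] [BorelSpace S]
    [TopologicalSpace.MetrizableSpace S]
    [TopologicalSpace A] [MeasurableSpace A] [BorelSpace A]
    [TopologicalSpace.MetrizableSpace A] [CompactSpace A]
    (q : S × A → ℝ) (hq_cont : Continuous q) (hq_nonneg : ∀ p, 0 ≤ q p)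
    (κ : Kernel (S × A) S)
    (hκ_mass : ∀ p, κ p Set.univ = ENNReal.ofReal (q p))
    (hκ_cont : ∀ f : S → ℝ, Continuous f → (∃ C, ∀ y, |f y| ≤ C) →
      Continuous (fun p : S × A => (∫ y, f y ∂(κ p)) / q p))
    (c : S × A → ℝ≥0∞) (hc : LowerSemicontinuous c)
    (η : Measure (S × A))
    (hc_int : ∫⁻ p, c p ∂η < ∞)
    (h_bal : ∀ Γ : Set S, MeasurableSet Γ →
      ∫⁻ p, κ p Γ ∂η ≤ 1 + ∫⁻ p in Γ ×ˢ (Set.univ : Set A), ENNReal.ofReal (q p) ∂η)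
    (B : ℕ → Set S) (hB_open : ∀ j, IsOpen (B j)) (hB_mono : Monotone B)
    (hB_fin : ∀ j, ∫⁻ p in (B j) ×ˢ (Set.univ : Set A), ENNReal.ofReal (q p) ∂η < ∞) :
    ∃ E : ℕ → Set S, (∀ j, IsOpen (E j)) ∧
      {x : S | ∀ a : A, 0 < κ (x, a) (⋃ j, B j) + c (x, a)} = ⋃ j, E j ∧
      ∀ j, ∫⁻ p in (E j) ×ˢ (Set.univ : Set A), ENNReal.ofReal (q p) ∂η < ∞ := by
  classical
  let _ : MetricSpace S := TopologicalSpace.metrizableSpaceMetric S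
  have hfin : ∀ p, IsFiniteMeasure (κ p) := fun p => ⟨by rw [hκ_mass]; exact ENNReal.ofReal_lt_top⟩
  let g : ℕ → S → ℝ≥0∞ := fun n y => min 1 (Metric.infEDist y (B n)ᶜ)
  have hg1 : ∀ n y, g n y ≤ 1 := fun n y => min_le_left _ _
  have hgt : ∀ n y, g n y ≠ ∞ := fun n y => ne_top_of_le_ne_top ENNReal.one_ne_top (hg1 n y)
  have hgc : ∀ n, Continuous (g n) := fun n => continuous_const.min Metric.continuous_infEDist
  have hg0 : ∀ n y, y ∉ B n → g n y = 0 := by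
    intro n y hy
    have : Metric.infEDist y (B n)ᶜ = 0 := Metric.infEDist_zero_of_mem hy
    simp [g, this]
  have hgpos : ∀ n y, y ∈ B n → 0 < g n y := by
    intro n y hy
    refine lt_min one_pos (pos_iff_ne_zero.2 fun h => ?_)
    exact ((Metric.mem_iff_infEDist_zero_of_closed (hB_open n).isClosed_compl).2 h) hy
  have hgmono : Monotone g := by
    intro m n hmn y
    exact min_le_min le_rfl (Metric.infEDist_anti (compl_subset_compl.2 (hB_mono hmn)))
  let h : ℕ → S → ℝ := fun n y => (g n y).toReal
  have hhc : ∀ n, Continuous (h n) := fun n => by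
    refine continuous_iff_continuousAt.2 fun y => ?_
    exact (ENNReal.tendsto_toReal (hgt n y)).comp (hgc n).continuousAt
  have hhn : ∀ n y, 0 ≤ h n y := fun n y => ENNReal.toReal_nonneg
  have hh1 : ∀ n y, h n y ≤ 1 := fun n y => by
    have := ENNReal.toReal_mono ENNReal.one_ne_top (hg1 n y)
    simpa using this
  have hint : ∀ n p, ∫ y, h n y ∂(κ p) = (∫⁻ y, g n y ∂(κ p)).toReal := by
    intro n p
    exact integral_toReal (hgc n).measurable.aemeasurable
      (Filter.Eventually.of_forall fun y => (hgt n y).lt_top)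
  have hgle : ∀ n p, ∫⁻ y, g n y ∂(κ p) ≤ κ p (B n) := by
    intro n p
    rw [← lintegral_indicator_one (hB_open n).measurableSet]
    refine lintegral_mono fun y => ?_
    by_cases hy : y ∈ B n
    · simpa [hy] using hg1 n y
    · simp [hy, hg0 n y hy]
  have hgfin : ∀ n p, ∫⁻ y, g n y ∂(κ p) ≠ ∞ := fun n p =>
    ne_top_of_le_ne_top (measure_ne_top _ _) (hgle n p)
  let r : ℕ → S × A → ℝ := fun n p => (∫ y, h n y ∂(κ p)) / q p
  have hrc : ∀ n, Continuous (r n) := fun n =>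
    hκ_cont (h n) (hhc n) ⟨1, fun y => by rw [abs_of_nonneg (hhn n y)]; exact hh1 n y⟩
  have hrmono : Monotone r := by
    intro m n hmn p
    refine div_le_div_of_nonneg_right ?_ (hq_nonneg p)
    rw [hint, hint]
    exact ENNReal.toReal_mono (hgfin n p) (lintegral_mono (hgmono hmn))
  let U : ℕ → Set (S × A) := fun n =>
    {p | 1 / ((n : ℝ) + 1) < r n p} ∪ ({p | ((n : ℝ≥0∞) + 1)⁻¹ < c p} ∩ {p | q p < (n : ℝ) + 1})
  have hUo : ∀ n, IsOpen (U n) := fun n =>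
    (isOpen_lt continuous_const (hrc n)).union
      ((hc.isOpen_preimage _).inter (isOpen_lt hq_cont continuous_const))
  have hUmono : Monotone U := by
    intro m n hmn p hp
    have hmn' : (m : ℝ) ≤ n := by exact_mod_cast hmn
    have hmn'' : (m : ℝ≥0∞) ≤ n := by exact_mod_cast hmn
    rcases hp with hp | ⟨hp, hp'⟩
    · left
      exact lt_of_le_of_lt (one_div_le_one_div_of_le (by positivity) (by linarith))
        (lt_of_lt_of_le hp (hrmono hmn p))
    · right
      refine ⟨lt_of_le_of_lt (ENNReal.inv_le_inv.2 (by gcongr)) hp, ?_⟩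
      have hp2 : q p < (m : ℝ) + 1 := hp'
      show q p < (n : ℝ) + 1
      linarith
  have hUpos : ∀ n p, p ∈ U n → 0 < κ p (⋃ j, B j) + c p := by
    intro n p hp
    rcases hp with hp | ⟨hp, -⟩
    · have h1 : 0 < r n p := lt_trans (by positivity) hp
      have h2 : (∫⁻ y, g n y ∂(κ p)) ≠ 0 := by
        intro h0
        simp [r, hint, h0] at h1
      have h3 : 0 < κ p (B n) := lt_of_lt_of_le (pos_iff_ne_zero.2 h2) (hgle n p)
      exact lt_of_lt_of_le h3 ((measure_mono (subset_iUnion B n)).trans le_self_add)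
    · exact lt_of_lt_of_le (lt_of_le_of_lt zero_le hp) le_add_self
  have hUcov : ∀ p, 0 < κ p (⋃ j, B j) + c p → ∃ n, p ∈ U n := by
    intro p hp
    by_cases hk : κ p (⋃ j, B j) = 0
    · have hcp : c p ≠ 0 := by
        intro h0
        simp [hk, h0] at hp
      obtain ⟨n1, hn1⟩ := ENNReal.exists_inv_nat_lt hcp
      obtain ⟨n2, hn2⟩ := exists_nat_gt (q p)
      refine ⟨max n1 n2, Or.inr ⟨?_, ?_⟩⟩
      · refine lt_of_le_of_lt (ENNReal.inv_le_inv.2 ?_) hn1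
        have : (n1 : ℝ≥0∞) ≤ (max n1 n2 : ℕ) := by exact_mod_cast le_max_left _ _
        exact this.trans le_self_add
      · have : (n2 : ℝ) ≤ (max n1 n2 : ℕ) := by exact_mod_cast le_max_right _ _
        show q p < ((max n1 n2 : ℕ) : ℝ) + 1
        linarith
    · have : ∃ j, κ p (B j) ≠ 0 := by
        by_contra! hcon
        exact hk (measure_iUnion_null hcon)
      obtain ⟨j, hj⟩ := this
      have hgj : (∫⁻ y, g j y ∂(κ p)) ≠ 0 := by
        intro h0
        rw [lintegral_eq_zero_iff (hgc j).measurable] at h0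
        apply hj
        refine measure_mono_null (fun y hy => ?_) h0
        exact (hgpos j y hy).ne'
      have hqp : 0 < q p := by
        have : 0 < κ p univ := lt_of_lt_of_le (pos_iff_ne_zero.2 hj) (measure_mono (subset_univ _))
        rw [hκ_mass] at this
        exact ENNReal.ofReal_pos.1 this
      have hrj : 0 < r j p := by
        refine div_pos ?_ hqp
        rw [hint]
        exact ENNReal.toReal_pos hgj (hgfin j p)
      obtain ⟨n1, hn1⟩ := exists_nat_one_div_lt hrj
      refine ⟨max j n1, Or.inl ?_⟩
      have : (n1 : ℝ) ≤ (max j n1 : ℕ) := by exact_mod_cast le_max_right _ _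
      exact lt_of_le_of_lt (one_div_le_one_div_of_le (by positivity) (by linarith))
        (lt_of_lt_of_le hn1 (hrmono (le_max_left _ _) p))
  have hUq : ∀ n p, p ∈ U n → ENNReal.ofReal (q p) ≤
      ((n : ℝ≥0∞) + 1) * κ p (B n) + (((n : ℝ≥0∞) + 1) * ((n : ℝ≥0∞) + 1)) * c p := by
    intro n p hp
    have hcast : ENNReal.ofReal ((n : ℝ) + 1) = (n : ℝ≥0∞) + 1 := by
      rw [ENNReal.ofReal_add (by positivity) zero_le_one]; simp
    rcases hp with hp | ⟨hp, hp'⟩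
    · refine le_trans ?_ le_self_add
      have hqp : 0 < q p := by
        refine lt_of_le_of_ne (hq_nonneg p) fun h0 => ?_
        have h1 : 0 < r n p := lt_trans (by positivity) hp
        simp [r, ← h0] at h1
      have h1 : q p ≤ ((n : ℝ) + 1) * ∫ y, h n y ∂(κ p) := by
        have h2 : 1 / ((n : ℝ) + 1) < (∫ y, h n y ∂(κ p)) / q p := hp
        rw [div_lt_div_iff₀ (by positivity) hqp] at h2
        linarith
      calc ENNReal.ofReal (q p) ≤ ENNReal.ofReal (((n : ℝ) + 1) * ∫ y, h n y ∂(κ p)) :=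
            ENNReal.ofReal_le_ofReal h1
        _ = ((n : ℝ≥0∞) + 1) * ∫⁻ y, g n y ∂(κ p) := by
            rw [ENNReal.ofReal_mul (by positivity), hcast, hint, ENNReal.ofReal_toReal (hgfin n p)]
        _ ≤ _ := by gcongr; exact hgle n p
    · refine le_trans ?_ le_add_self
      have h1 : ENNReal.ofReal (q p) ≤ (n : ℝ≥0∞) + 1 := by
        rw [← hcast]; exact ENNReal.ofReal_le_ofReal (le_of_lt hp')
      have hN0 : ((n : ℝ≥0∞) + 1) ≠ 0 := by simp
      have hNt : ((n : ℝ≥0∞) + 1) ≠ ∞ := by simp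
      have h2 : 1 ≤ ((n : ℝ≥0∞) + 1) * c p := by
        have hp2 : ((n : ℝ≥0∞) + 1)⁻¹ < c p := hp
        exact (ENNReal.mul_inv_cancel hN0 hNt).symm.le.trans (mul_le_mul' le_rfl hp2.le)
      calc ENNReal.ofReal (q p) ≤ ((n : ℝ≥0∞) + 1) * 1 := by simpa using h1
        _ ≤ ((n : ℝ≥0∞) + 1) * (((n : ℝ≥0∞) + 1) * c p) := by gcongr
        _ = _ := by rw [mul_assoc]
  have hEo : ∀ n, IsOpen {x : S | ∀ a : A, (x, a) ∈ U n} := by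
    intro n
    have hcl : IsClosed (Prod.fst '' (U n)ᶜ) :=
      isClosedMap_fst_of_compactSpace _ (hUo n).isClosed_compl
    convert hcl.isOpen_compl using 1
    ext x
    simp
  refine ⟨fun n => {x | ∀ a : A, (x, a) ∈ U n}, hEo, ?_, ?_⟩
  · ext x
    simp only [mem_ofPred_eq, mem_iUnion]
    constructor
    · intro hx
      obtain ⟨n, hn⟩ := isCompact_univ.elim_directed_cover (fun n => {a : A | (x, a) ∈ U n})
        (fun n => (hUo n).preimage (Continuous.prodMk_right x))
        (fun a _ => mem_iUnion.2 (hUcov (x, a) (hx a)))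
        (Monotone.directed_le fun m n hmn a ha => hUmono hmn ha)
      exact ⟨n, fun a => hn (mem_univ a)⟩
    · rintro ⟨n, hn⟩ a
      exact hUpos n _ (hn a)
  · intro n
    have hN : ((n : ℝ≥0∞) + 1) ≠ ∞ := by simp
    refine lt_of_le_of_lt (setLIntegral_mono' ((hEo n).measurableSet.prod MeasurableSet.univ)
      (g := fun p => ((n : ℝ≥0∞) + 1) * κ p (B n) +
        (((n : ℝ≥0∞) + 1) * ((n : ℝ≥0∞) + 1)) * c p) ?_) ?_
    · rintro ⟨x, a⟩ ⟨hx, -⟩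
      exact hUq n _ (hx a)
    · refine lt_of_le_of_lt (setLIntegral_le_lintegral _ _) ?_
      have hm : Measurable fun p => κ p (B n) := κ.measurable_coe (hB_open n).measurableSet
      rw [lintegral_add_left (hm.const_mul _), lintegral_const_mul _ hm,
        lintegral_const_mul' _ _ (ENNReal.mul_ne_top hN hN)]
      refine ENNReal.add_lt_top.2 ⟨ENNReal.mul_lt_top hN.lt_top ?_,
        ENNReal.mul_lt_top (ENNReal.mul_lt_top hN.lt_top hN.lt_top) hc_int⟩
      exact lt_of_le_of_lt (h_bal _ (hB_open n).measurableSet)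
        (ENNReal.add_lt_top.2 ⟨ENNReal.one_lt_top, hB_fin n⟩)
end

section
/- Let S and A be metrizable topological spaces equipped with their Borel σ-algebras, with A compact. Let q : S × A → ℝ be continuous and nonnegative, let κ be a kernel from S × A to S with total mass κ(x,a)(S) = q(x,a) for every (x,a), and assume that for every bounded continuous f : S → ℝ the map (x,a) ↦ (∫ f dκ(x,a)) / q(x,a) (with the convention 0/0 := 0) is continuous on S × A. Let c : S × A → [0,∞] be lower semicontinuous, and let η be a Borel measure on S × A such that ∫ c dη < ∞ and such that for every Borel set Γ ⊆ S one has ∫_{S×A} κ(x,a)(Γ) η(d(x,a)) ≤ 1 + ∫_{Γ×A} q(x,a) η(d(x,a)). Suppose (B_j)_{j≥1} is an increasing sequence of open subsets of S satisfying ∫_{B_j×A} q(x,a) η(d(x,a)) < ∞ for every j. Then, setting Y := {x ∈ S : for all a ∈ A, κ(x,a)(⋃_j B_j) + c(x,a) > 0}, there exists a sequence (Ẽ_j)_{j≥1} of open subsets of S such that Y = ⋃_j Ẽ_j and η(Ẽ_j × A) < ∞ for every j. -/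
open MeasureTheory ProbabilityTheory Set
open scoped ENNReal

/-- The measure of an open set under the kernel is lower semicontinuous. -/
lemma lsc_kernel_open_aux {S X : Type*}
    [TopologicalSpace S] [MeasurableSpace S] [BorelSpace S]
    [TopologicalSpace.MetrizableSpace S] [TopologicalSpace X] [MeasurableSpace X]
    (q : X → ℝ) (hq_cont : Continuous q)
    (κ : Kernel X S)
    (hκ_mass : ∀ p, κ p Set.univ = ENNReal.ofReal (q p))
    (hκ_cont : ∀ f : S → ℝ, Continuous f → (∃ C, ∀ y, |f y| ≤ C) →
      Continuous (fun p : X => (∫ y, f y ∂(κ p)) / q p))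
    (hq_nonneg : ∀ p, 0 ≤ q p)
    (G : Set S) (hG : IsOpen G) : LowerSemicontinuous (fun p => κ p G) := by
  have hF : IsClosed Gᶜ := hG.isClosed_compl
  have hfin : ∀ p, IsFiniteMeasure (κ p) := fun p => ⟨by rw [hκ_mass]; exact ENNReal.ofReal_lt_top⟩
  let f : ℕ → S → ℝ := fun n y => 1 - (hF.apprSeq n y : ℝ)
  have hle1 : ∀ n y, (hF.apprSeq n y : ℝ) ≤ 1 := fun n y => by
    exact_mod_cast HasOuterApproxClosed.apprSeq_apply_le_one hF n y
  have hf0 : ∀ n y, 0 ≤ f n y := fun n y => sub_nonneg.2 (hle1 n y)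
  have hf1 : ∀ n y, f n y ≤ 1 := fun n y => sub_le_self _ (NNReal.coe_nonneg _)
  have hfc : ∀ n, Continuous (f n) := fun n => by
    have := (hF.apprSeq n).continuous
    fun_prop
  have hcont : ∀ n, Continuous (fun p => ∫ y, f n y ∂(κ p)) := fun n => by
    have h := hq_cont.mul (hκ_cont (f n) (hfc n) ⟨1, fun y => by
      rw [abs_of_nonneg (hf0 n y)]; exact hf1 n y⟩)
    convert h using 2 with p
    by_cases hp : q p = 0
    · have : κ p = 0 := by
        rw [← Measure.measure_univ_eq_zero, hκ_mass, hp, ENNReal.ofReal_zero]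
      simp [this]
    · exact (mul_div_cancel₀ _ hp).symm
  have hInteg : ∀ n p, ENNReal.ofReal (∫ y, f n y ∂(κ p)) = ∫⁻ y, ENNReal.ofReal (f n y) ∂(κ p) := by
    intro n p
    have := hfin p
    refine ofReal_integral_eq_lintegral_ofReal ?_ (Filter.Eventually.of_forall (hf0 n))
    refine Integrable.of_bound (hfc n).measurable.aestronglyMeasurable 1
      (Filter.Eventually.of_forall fun y => ?_)
    rw [Real.norm_eq_abs, abs_of_nonneg (hf0 n y)]; exact hf1 n y
  have hsup : (fun p => κ p G) = fun p => ⨆ n, ENNReal.ofReal (∫ y, f n y ∂(κ p)) := by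
    funext p
    have := hfin p
    apply le_antisymm
    · have ht : Filter.Tendsto (fun n => ∫⁻ y, ENNReal.ofReal (f n y) ∂(κ p)) Filter.atTop
          (nhds (∫⁻ y, G.indicator 1 y ∂(κ p))) := by
        refine tendsto_lintegral_of_dominated_convergence (fun _ => 1)
          (fun n => (hfc n).measurable.ennreal_ofReal) (fun n => Filter.Eventually.of_forall
            fun y => by simpa using hf1 n y) (by simp)
          (Filter.Eventually.of_forall fun y => ?_)
        have h1 := (tendsto_pi_nhds.1 (HasOuterApproxClosed.tendsto_apprSeq hF)) y
        have h2 : Filter.Tendsto (fun n => ENNReal.ofReal (f n y)) Filter.atTop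
            (nhds (ENNReal.ofReal (1 - ((Gᶜ.indicator (fun _ => (1 : NNReal)) y : NNReal) : ℝ)))) := by
          apply ENNReal.tendsto_ofReal
          exact ((NNReal.tendsto_coe.2 h1).const_sub 1)
        convert h2 using 2
        by_cases hy : y ∈ G <;> simp [hy]
      rw [lintegral_indicator_one hG.measurableSet] at ht
      refine le_of_tendsto' ht fun n => ?_
      rw [← hInteg]
      exact le_iSup (fun n => ENNReal.ofReal (∫ y, f n y ∂(κ p))) n
    · refine iSup_le fun n => ?_
      rw [hInteg, ← lintegral_indicator_one hG.measurableSet]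
      refine lintegral_mono fun y => ?_
      by_cases hy : y ∈ G
      · simpa [hy] using hf1 n y
      · have : hF.apprSeq n y = 1 := HasOuterApproxClosed.apprSeq_apply_eq_one hF n hy
        simp [hy, f, this]
  rw [hsup]
  exact lowerSemicontinuous_iSup fun n =>
    (ENNReal.continuous_ofReal.comp (hcont n)).lowerSemicontinuous

/-- Abstract form of Lemma 4.3(b): existence of open sets `Ẽ j` covering
`Y = {x | ∀ a, κ(x,a)(⋃ j, B j) + c(x,a) > 0}`, each with `η(Ẽ j × A) < ∞`. -/
theorem exists_open_cover_finite_eta_measure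
    {S A : Type*}
    [TopologicalSpace S] [MeasurableSpace S] [BorelSpace S]
    [TopologicalSpace.MetrizableSpace S]
    [TopologicalSpace A] [MeasurableSpace A] [BorelSpace A]
    [TopologicalSpace.MetrizableSpace A] [CompactSpace A]
    (q : S × A → ℝ) (hq_cont : Continuous q) (hq_nonneg : ∀ p, 0 ≤ q p)
    (κ : Kernel (S × A) S)
    (hκ_mass : ∀ p, κ p Set.univ = ENNReal.ofReal (q p))
    (hκ_cont : ∀ f : S → ℝ, Continuous f → (∃ C, ∀ y, |f y| ≤ C) →
      Continuous (fun p : S × A => (∫ y, f y ∂(κ p)) / q p))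
    (c : S × A → ℝ≥0∞) (hc : LowerSemicontinuous c)
    (η : Measure (S × A))
    (hc_int : ∫⁻ p, c p ∂η < ∞)
    (h_bal : ∀ Γ : Set S, MeasurableSet Γ →
      ∫⁻ p, κ p Γ ∂η ≤ 1 + ∫⁻ p in Γ ×ˢ (Set.univ : Set A), ENNReal.ofReal (q p) ∂η)
    (B : ℕ → Set S) (hB_open : ∀ j, IsOpen (B j)) (hB_mono : Monotone B)
    (hB_fin : ∀ j, ∫⁻ p in (B j) ×ˢ (Set.univ : Set A), ENNReal.ofReal (q p) ∂η < ∞) :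
    ∃ E : ℕ → Set S, (∀ j, IsOpen (E j)) ∧
      {x : S | ∀ a : A, 0 < κ (x, a) (⋃ j, B j) + c (x, a)} = ⋃ j, E j ∧
      ∀ j, η ((E j) ×ˢ (Set.univ : Set A)) < ∞ := by
  have hlsc : ∀ j, LowerSemicontinuous (fun p => κ p (B j) + c p) := fun j =>
    (lsc_kernel_open_aux q hq_cont κ hκ_mass hκ_cont hq_nonneg (B j) (hB_open j)).add hc
  let t : ℕ → ℝ≥0∞ := fun j => ((j : ℝ≥0∞) + 1)⁻¹
  have ht_anti : Antitone t := fun i j hij => by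
    apply ENNReal.inv_le_inv.2
    gcongr
  have ht0 : ∀ j, t j ≠ 0 := fun j => by simp [t]
  let U : ℕ → Set (S × A) := fun j => {p | t j < κ p (B j) + c p}
  have hU : ∀ j, IsOpen (U j) := fun j => (hlsc j).isOpen_preimage (t j)
  have hUmono : Monotone U := fun i j hij p hp =>
    lt_of_le_of_lt (ht_anti hij) (lt_of_lt_of_le hp (by gcongr; exact hB_mono hij))
  refine ⟨fun j => {x | ∀ a, (x, a) ∈ U j}, fun j => ?_, ?_, fun j => ?_⟩
  · have h : IsClosed (Prod.fst '' (U j)ᶜ : Set S) :=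
      isClosedMap_fst_of_compactSpace _ (hU j).isClosed_compl
    convert h.isOpen_compl using 1
    ext x
    simp
  · ext x
    simp only [mem_ofPred_eq, mem_iUnion]
    constructor
    · intro hx
      have hcov : (univ : Set A) ⊆ ⋃ j, {a | (x, a) ∈ U j} := by
        intro a _
        have h1 : Filter.Tendsto (fun j => κ (x, a) (B j) + c (x, a)) Filter.atTop
            (nhds (κ (x, a) (⋃ j, B j) + c (x, a))) :=
          (tendsto_measure_iUnion_atTop hB_mono).add tendsto_const_nhds
        have h2 : Filter.Tendsto t Filter.atTop (nhds 0) := by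
          have := (Filter.tendsto_add_atTop_iff_nat 1).2 ENNReal.tendsto_inv_nat_nhds_zero
          simpa [t] using this
        obtain ⟨j, hj⟩ := (h2.eventually_lt h1 (hx a)).exists
        exact mem_iUnion.2 ⟨j, hj⟩
      obtain ⟨j, hj⟩ := isCompact_univ.elim_directed_cover (fun j => {a | (x, a) ∈ U j})
        (fun j => (hU j).preimage (by fun_prop)) hcov
        (Monotone.directed_le fun i j hij a ha => hUmono hij ha)
      exact ⟨j, fun a => hj (mem_univ a)⟩
    · rintro ⟨j, hj⟩ a
      refine lt_of_le_of_lt (zero_le) (lt_of_lt_of_le (hj a) ?_)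
      gcongr
      exact subset_iUnion B j
  · have hInteg : ∫⁻ p, (κ p (B j) + c p) ∂η < ∞ := by
      rw [lintegral_add_left (κ.measurable_coe (hB_open j).measurableSet)]
      refine ENNReal.add_lt_top.2 ⟨(h_bal _ (hB_open j).measurableSet).trans_lt ?_, hc_int⟩
      exact ENNReal.add_lt_top.2 ⟨ENNReal.one_lt_top, hB_fin j⟩
    refine lt_of_le_of_lt (measure_mono ?_)
      (meas_ge_le_lintegral_div (hlsc j).measurable.aemeasurable (ht0 j)
        (by simp [t]) |>.trans_lt (ENNReal.div_lt_top hInteg.ne (ht0 j)))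
    rintro ⟨x, a⟩ ⟨hx, -⟩
    exact le_of_lt (show t j < κ (x, a) (B j) + c (x, a) from hx a)
end

section
/- Let S and A be metrizable topological spaces equipped with their Borel σ-algebras, with A compact. Let q : S × A → ℝ be continuous and nonnegative, let κ be a kernel from S × A to S with total mass κ(x,a)(S) = q(x,a) for every (x,a), and assume that for every bounded continuous f : S → ℝ the map (x,a) ↦ (∫ f dκ(x,a)) / q(x,a) (with the convention 0/0 := 0) is continuous on S × A. Let c : S × A → [0,∞] be lower semicontinuous, and let η be a Borel measure on S × A such that ∫ c dη < ∞ and such that for every Borel set Γ ⊆ S one has ∫_{S×A} κ(x,a)(Γ) η(d(x,a)) ≤ 1 + ∫_{Γ×A} q(x,a) η(d(x,a)). Define recursively W_1 := {x ∈ S : for all a ∈ A, c(x,a) > 0} and, for j ≥ 1, W_{j+1} := {x ∈ S : for all a ∈ A, κ(x,a)(⋃_{i=1}^j W_i) + c(x,a) > 0}, and set W := ⋃_{j≥1} W_j. Then every W_j is open in S (hence W is open), and the marginal measure Γ ↦ η(Γ × A) restricted to W is σ-finite; that is, there exists a countable family (F_n) of Borel subsets of S with W = ⋃_n F_n and η(F_n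 × A) < ∞ for every n. -/
open MeasureTheory ProbabilityTheory Set
open scoped ENNReal

/-- `V` is a countable union of open sets of finite marginal measure. -/
def GoodSet {S A : Type*} [TopologicalSpace S] [MeasurableSpace S] [MeasurableSpace A]
    (η : Measure (S × A)) (V : Set S) : Prop :=
  ∃ F : ℕ → Set S, (∀ n, IsOpen (F n)) ∧ V = ⋃ n, F n ∧
    ∀ n, η ((F n) ×ˢ (Set.univ : Set A)) < ∞

theorem tube_open {S A : Type*} [TopologicalSpace S] [TopologicalSpace A] [CompactSpace A]
    {U : Set (S × A)} (hU : IsOpen U) : IsOpen {x : S | ∀ a : A, (x, a) ∈ U} := by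
  rw [isOpen_iff_mem_nhds]
  intro x hx
  have h := (isCompact_univ (X := A)).eventually_forall_of_forall_eventually
    (x₀ := x) (P := fun x a => (x, a) ∈ U) (fun a _ => by
      exact hU.mem_nhds (hx a))
  filter_upwards [h] with y hy a
  exact hy a (mem_univ a)

theorem goodSet_iUnion {S A : Type*} [TopologicalSpace S] [MeasurableSpace S] [MeasurableSpace A]
    {η : Measure (S × A)} {V : ℕ → Set S} (h : ∀ n, GoodSet η (V n)) :
    GoodSet η (⋃ n, V n) := by
  choose F h1 h2 h3 using h
  refine ⟨fun n => F n.unpair.1 n.unpair.2, fun n => h1 _ _, ?_, fun n => h3 _ _⟩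
  ext x
  simp only [h2, mem_iUnion]
  constructor
  · rintro ⟨i, j, hx⟩
    exact ⟨Nat.pair i j, by simpa using hx⟩
  · rintro ⟨n, hx⟩
    exact ⟨_, _, hx⟩

theorem goodSet_key {S A : Type*}
    [TopologicalSpace S] [MeasurableSpace S] [BorelSpace S]
    [TopologicalSpace A] [MeasurableSpace A] [BorelSpace A]
    [TopologicalSpace.MetrizableSpace A] [CompactSpace A]
    {η : Measure (S × A)} (h : ℕ → S × A → ℝ≥0∞) (hl : ∀ n, LowerSemicontinuous (h n))
    (hm : Monotone h) (hi : ∀ n, ∫⁻ p, h n p ∂η < ∞) :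
    GoodSet η {x : S | ∀ a : A, ∃ n, 0 < h n (x, a)} := by
  letI := TopologicalSpace.metrizableSpaceMetric A
  have hmono : ∀ m n : ℕ, m ≤ n → ∀ p, ((m : ℝ≥0∞) + 1)⁻¹ < h m p →
      ((n : ℝ≥0∞) + 1)⁻¹ < h n p := by
    intro m n hmn p hp
    refine lt_of_le_of_lt ?_ (hp.trans_le (hm hmn p))
    gcongr
  have hpos : ∀ n : ℕ, 0 < ((n : ℝ≥0∞) + 1)⁻¹ := by
    intro n
    simp
  refine ⟨fun n => {x : S | ∀ a : A, (x, a) ∈ {p | ((n : ℝ≥0∞) + 1)⁻¹ < h n p}}, ?_, ?_, ?_⟩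
  · intro n
    exact tube_open ((hl n).isOpen_preimage _)
  · ext x
    simp only [mem_ofPred_eq, mem_iUnion]
    constructor
    · intro hx
      have hcov : (univ : Set A) ⊆ ⋃ n : ℕ, {a | ((n : ℝ≥0∞) + 1)⁻¹ < h n (x, a)} := by
        intro a _
        obtain ⟨m, hm0⟩ := hx a
        obtain ⟨k, hk⟩ := ENNReal.exists_inv_nat_lt hm0.ne'
        refine mem_iUnion.2 ⟨max m k, ?_⟩
        refine lt_of_le_of_lt ?_ (hk.trans_le (hm (le_max_left m k) (x, a)))
        apply ENNReal.inv_le_inv.2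
        calc (k : ℝ≥0∞) ≤ (max m k : ℕ) := by exact_mod_cast le_max_right m k
          _ ≤ _ := le_self_add
      obtain ⟨n, hn⟩ := (isCompact_univ (X := A)).elim_directed_cover _
        (fun n => ((hl n).isOpen_preimage _).preimage (Continuous.prodMk_right x)) hcov
        (Monotone.directed_le (fun m n hmn a ha => hmono m n hmn _ ha))
      exact ⟨n, fun a => hn (mem_univ a)⟩
    · rintro ⟨n, hn⟩ a
      exact ⟨n, (hpos n).trans (hn a)⟩
  · intro n
    refine lt_of_le_of_lt (measure_mono (t := {p | ((n : ℝ≥0∞) + 1)⁻¹ ≤ h n p}) ?_) ?_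
    · rintro ⟨x, a⟩ ⟨hx, -⟩
      have h1 : ((n : ℝ≥0∞) + 1)⁻¹ < h n (x, a) := hx a
      exact h1.le
    · refine lt_of_le_of_lt (meas_ge_le_lintegral_div (hl n).measurable.aemeasurable
        (hpos n).ne' (by simp)) ?_
      exact ENNReal.div_lt_top (hi n).ne (hpos n).ne'

theorem goodSet_refine {S A : Type*}
    [TopologicalSpace S] [MeasurableSpace S] [BorelSpace S]
    [TopologicalSpace A] [MeasurableSpace A] [BorelSpace A] [CompactSpace A]
    {η : Measure (S × A)} (q : S × A → ℝ) (hq : Continuous q) {V : Set S} (hV : GoodSet η V) :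
    ∃ G : ℕ → Set S, (∀ n, IsOpen (G n)) ∧ Monotone G ∧ V = ⋃ n, G n ∧
      ∀ n, ∫⁻ p in (G n) ×ˢ (Set.univ : Set A), ENNReal.ofReal (q p) ∂η < ∞ := by
  obtain ⟨F, h1, h2, h3⟩ := hV
  have hop : ∀ n : ℕ, IsOpen {x : S | ∀ a : A, (x, a) ∈ {p | q p < n}} := fun n =>
    tube_open (isOpen_lt hq continuous_const)
  refine ⟨fun n => (⋃ i ∈ Finset.range (n + 1), F i) ∩
    {x : S | ∀ a : A, (x, a) ∈ {p | q p < n}}, ?_, ?_, ?_, ?_⟩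
  · intro n
    exact (isOpen_biUnion fun i _ => h1 i).inter (hop n)
  · intro m n hmn x hx
    have hx2 : ∀ a, q (x, a) < n := fun a => by
      have h4 : q (x, a) < m := hx.2 a
      exact lt_of_lt_of_le h4 (by exact_mod_cast hmn)
    refine ⟨?_, fun a => hx2 a⟩
    have := hx.1
    simp only [mem_iUnion, Finset.mem_range] at this ⊢
    obtain ⟨i, hi, hxi⟩ := this
    exact ⟨i, by omega, hxi⟩
  · rw [h2]
    ext x
    simp only [mem_iUnion, mem_inter_iff, Finset.mem_range, mem_ofPred_eq]
    constructor
    · rintro ⟨i, hi⟩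
      obtain ⟨C, hC⟩ := (isCompact_range (hq.comp (Continuous.prodMk_right x))).bddAbove
      obtain ⟨k, hk⟩ := exists_nat_gt C
      refine ⟨max i k, ⟨i, by omega, hi⟩, fun a => ?_⟩
      have : q (x, a) ≤ C := hC (mem_range_self a)
      refine lt_of_le_of_lt this (hk.trans_le ?_)
      exact_mod_cast le_max_right i k
    · rintro ⟨n, ⟨i, -, hi⟩, -⟩
      exact ⟨i, hi⟩
  · intro n
    refine lt_of_le_of_lt (setLIntegral_mono' (g := fun _ => (n : ℝ≥0∞)) ?_ ?_) ?_
    · exact ((isOpen_biUnion fun i _ => h1 i).inter (hop n)).measurableSet.prod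
        MeasurableSet.univ
    · rintro ⟨x, a⟩ ⟨hx, -⟩
      rw [← ENNReal.ofReal_natCast]
      have h4 : q (x, a) < n := hx.2 a
      exact ENNReal.ofReal_le_ofReal h4.le
    · rw [setLIntegral_const]
      refine ENNReal.mul_lt_top (by simp) ?_
      refine lt_of_le_of_lt (measure_mono
        (t := ⋃ i ∈ Finset.range (n + 1), (F i) ×ˢ (Set.univ : Set A)) ?_) ?_
      · rintro ⟨x, a⟩ ⟨hx, -⟩
        have := hx.1
        simp only [mem_iUnion, mem_prod, mem_univ, and_true] at this ⊢
        exact this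
      · exact measure_biUnion_lt_top (Finset.finite_toSet _) (fun i _ => h3 i)

theorem kernel_lsc {S X : Type*}
    [TopologicalSpace S] [MeasurableSpace S] [BorelSpace S]
    [TopologicalSpace.MetrizableSpace S] [TopologicalSpace X] [MeasurableSpace X]
    (q : X → ℝ) (hq_cont : Continuous q)
    (κ : Kernel X S)
    (hκ_mass : ∀ p, κ p Set.univ = ENNReal.ofReal (q p))
    (hκ_cont : ∀ f : S → ℝ, Continuous f → (∃ C, ∀ y, |f y| ≤ C) →
      Continuous (fun p : X => (∫ y, f y ∂(κ p)) / q p))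
    {U : Set S} (hU : IsOpen U) : LowerSemicontinuous (fun p => κ p U) := by
  letI := TopologicalSpace.metrizableSpaceMetric S
  have hfin : ∀ p, IsFiniteMeasure (κ p) := fun p => ⟨by rw [hκ_mass]; simp⟩
  intro p t ht
  obtain ⟨F, hF1, -, hF3, hF4⟩ := hU.exists_iUnion_isClosed
  have hFt : ∃ n, t < κ p (F n) := by
    change t < κ p U at ht
    rw [← hF3, hF4.measure_iUnion] at ht
    exact lt_iSup_iff.1 ht
  obtain ⟨n, hn⟩ := hFt
  have hFU : F n ⊆ U := hF3 ▸ subset_iUnion F n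
  obtain ⟨f, hf0, hf1, hf⟩ := exists_continuous_zero_one_of_isClosed hU.isClosed_compl (hF1 n)
    (disjoint_compl_left.mono_right hFU)
  have hb : ∃ C, ∀ y, |f y| ≤ C := ⟨1, fun y => abs_le.2 ⟨by linarith [(hf y).1], (hf y).2⟩⟩
  have hc : Continuous (fun p => ∫ y, f y ∂(κ p)) := by
    have h := (hκ_cont f f.continuous hb).mul hq_cont
    refine h.congr fun x => ?_
    by_cases hx : q x = 0
    · have : κ x = 0 := by
        rw [← Measure.measure_univ_eq_zero, hκ_mass, hx]; simp
      simp [this]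
    · exact div_mul_cancel₀ _ hx
  have heq : ∀ x, ENNReal.ofReal (∫ y, f y ∂(κ x)) = ∫⁻ y, ENNReal.ofReal (f y) ∂(κ x) := by
    intro x
    refine ofReal_integral_eq_lintegral_ofReal ?_ (Filter.Eventually.of_forall fun y => (hf y).1)
    refine Integrable.of_bound f.continuous.measurable.aestronglyMeasurable 1
      (Filter.Eventually.of_forall fun y => ?_)
    exact abs_le.2 ⟨by linarith [(hf y).1], (hf y).2⟩
  have hlow : κ p (F n) ≤ ENNReal.ofReal (∫ y, f y ∂(κ p)) := by
    rw [heq, ← lintegral_indicator_one (hF1 n).measurableSet]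
    refine lintegral_mono fun y => ?_
    by_cases hy : y ∈ F n
    · simp [hy, hf1 hy]
    · simp [hy]
  have hup : ∀ x, ENNReal.ofReal (∫ y, f y ∂(κ x)) ≤ κ x U := by
    intro x
    rw [heq, ← lintegral_indicator_one hU.measurableSet]
    refine lintegral_mono fun y => ?_
    by_cases hy : y ∈ U
    · simpa [hy] using (hf y).2
    · have : f y = 0 := hf0 hy
      simp [hy, this]
  have := (ENNReal.continuous_ofReal.comp hc).continuousAt.eventually
    (lt_mem_nhds (hn.trans_le hlow))
  filter_upwards [this] with x hx
  exact lt_of_lt_of_le hx (hup x)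

/-- Abstract form of Lemma 4.4: the recursively defined sets `W j` are open (hence `W` is
open), and the marginal of the occupation measure `η` is σ-finite on `W = ⋃ j, W j`. -/
theorem marginal_sigmaFinite_on_W
    {S A : Type*}
    [TopologicalSpace S] [MeasurableSpace S] [BorelSpace S]
    [TopologicalSpace.MetrizableSpace S]
    [TopologicalSpace A] [MeasurableSpace A] [BorelSpace A]
    [TopologicalSpace.MetrizableSpace A] [CompactSpace A]
    (q : S × A → ℝ) (hq_cont : Continuous q) (hq_nonneg : ∀ p, 0 ≤ q p)
    (κ : Kernel (S × A) S)
    (hκ_mass : ∀ p, κ p Set.univ = ENNReal.ofReal (q p))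
    (hκ_cont : ∀ f : S → ℝ, Continuous f → (∃ C, ∀ y, |f y| ≤ C) →
      Continuous (fun p : S × A => (∫ y, f y ∂(κ p)) / q p))
    (c : S × A → ℝ≥0∞) (hc : LowerSemicontinuous c)
    (η : Measure (S × A))
    (hc_int : ∫⁻ p, c p ∂η < ∞)
    (h_bal : ∀ Γ : Set S, MeasurableSet Γ →
      ∫⁻ p, κ p Γ ∂η ≤ 1 + ∫⁻ p in Γ ×ˢ (Set.univ : Set A), ENNReal.ofReal (q p) ∂η)
    (W : ℕ → Set S)
    (hW0 : W 0 = {x : S | ∀ a : A, 0 < c (x, a)})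
    (hWsucc : ∀ j : ℕ,
      W (j + 1) = {x : S | ∀ a : A, 0 < κ (x, a) (⋃ i ≤ j, W i) + c (x, a)}) :
    (∀ j, IsOpen (W j)) ∧ IsOpen (⋃ j, W j) ∧
      ∃ F : ℕ → Set S, (∀ n, MeasurableSet (F n)) ∧ (⋃ j, W j) = ⋃ n, F n ∧
        ∀ n, η ((F n) ×ˢ (Set.univ : Set A)) < ∞ := by
  have hcm : Measurable c := by
    letI := TopologicalSpace.metrizableSpaceMetric A
    exact hc.measurable
  have hgood : ∀ j, GoodSet η (W j) := by
    intro j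
    induction j using Nat.strong_induction_on with
    | _ j ih =>
    cases j with
    | zero =>
      have h := goodSet_key (η := η) (fun _ : ℕ => c) (fun _ => hc) monotone_const
        (fun _ => hc_int)
      rw [hW0]
      simpa using h
    | succ j =>
      have hV : GoodSet η (⋃ i ≤ j, W i) := by
        have h := goodSet_iUnion (η := η) (V := fun i => W (min i j))
          (fun i => ih _ (by omega))
        convert h using 1
        ext x
        simp only [mem_iUnion]
        constructor
        · rintro ⟨i, hi, hx⟩
          exact ⟨i, by rwa [min_eq_left hi]⟩
        · rintro ⟨i, hx⟩
          exact ⟨_, min_le_right _ _, hx⟩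
      obtain ⟨G, hG1, hG2, hG3, hG4⟩ := goodSet_refine q hq_cont hV
      have h := goodSet_key (η := η) (fun n p => κ p (G n) + c p)
        (fun n => (kernel_lsc q hq_cont κ hκ_mass hκ_cont (hG1 n)).add hc)
        (fun m n hmn p => by
          have := measure_mono (μ := κ p) (hG2 hmn)
          dsimp only
          gcongr)
        (fun n => by
          rw [lintegral_add_right _ hcm]
          refine ENNReal.add_lt_top.2 ⟨?_, hc_int⟩
          refine lt_of_le_of_lt (h_bal _ (hG1 n).measurableSet) ?_
          exact ENNReal.add_lt_top.2 ⟨by simp, hG4 n⟩)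
      rw [hWsucc]
      convert h using 1
      ext x
      simp only [mem_ofPred_eq]
      refine forall_congr' fun a => ?_
      rw [hG3]
      simp only [pos_iff_ne_zero, ne_eq, add_eq_zero, measure_iUnion_null_iff]
      by_cases h0 : c (x, a) = 0 <;> simp [h0]
  have hopen : ∀ j, IsOpen (W j) := by
    intro j
    obtain ⟨F, h1, h2, -⟩ := hgood j
    rw [h2]
    exact isOpen_iUnion h1
  refine ⟨hopen, isOpen_iUnion hopen, ?_⟩
  obtain ⟨F, h1, h2, h3⟩ := goodSet_iUnion hgood
  exact ⟨F, fun n => (h1 n).measurableSet, h2, h3⟩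
end

section
/- Let S and A be metrizable topological spaces equipped with their Borel σ-algebras, with A compact and nonempty. Let q : S × A → ℝ be continuous and nonnegative, let κ be a kernel from S × A to S with total mass κ(x,a)(S) = q(x,a) for every (x,a), and assume that for every bounded continuous f : S → ℝ the map (x,a) ↦ (∫ f dκ(x,a)) / q(x,a) (with the convention 0/0 := 0) is continuous on S × A. Let c : S × A → [0,∞] be lower semicontinuous. Define recursively W_1 := {x ∈ S : for all a ∈ A, c(x,a) > 0} and, for j ≥ 1, W_{j+1} := {x ∈ S : for all a ∈ A, κ(x,a)(⋃_{i=1}^j W_i) + c(x,a) > 0}, and set W := ⋃_{j≥1} W_j. Then for every x ∈ S \ W one has inf_{a∈A} { κ(x,a)(W) + c(x,a) } = 0, and moreover this infimum is attained: there exists a ∈ A with κ(x,a)(W) = 0 and c(x,a) = 0. -/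
open MeasureTheory ProbabilityTheory Set
open scoped ENNReal

/-- Positivity of the kernel on an open set is an open condition. -/
lemma isOpen_kernel_pos
    {S A : Type*}
    [TopologicalSpace S] [MeasurableSpace S] [BorelSpace S]
    [TopologicalSpace.MetrizableSpace S]
    [TopologicalSpace A] [MeasurableSpace A]
    (q : S × A → ℝ)
    (κ : Kernel (S × A) S)
    (hκ_mass : ∀ p, κ p Set.univ = ENNReal.ofReal (q p))
    (hκ_cont : ∀ f : S → ℝ, Continuous f → (∃ C, ∀ y, |f y| ≤ C) →
      Continuous (fun p : S × A => (∫ y, f y ∂(κ p)) / q p))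
    (U : Set S) (hU : IsOpen U) : IsOpen {p : S × A | 0 < κ p U} := by
  let _ := TopologicalSpace.metrizableSpaceMetric S
  set f : S → ℝ := fun y => (min 1 (Metric.infEDist y Uᶜ)).toReal with hf
  have hne : ∀ y, min 1 (Metric.infEDist y Uᶜ) ≠ ⊤ := fun y =>
    ne_top_of_le_ne_top ENNReal.one_ne_top (min_le_left _ _)
  have hfc : Continuous f := by
    refine ENNReal.continuousOn_toReal.comp_continuous
      (continuous_const.min Metric.continuous_infEDist) hne
  have hf0 : ∀ y, 0 ≤ f y := fun y => ENNReal.toReal_nonneg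
  have hf1 : ∀ y, |f y| ≤ 1 := fun y => by
    rw [abs_of_nonneg (hf0 y)]
    exact ENNReal.toReal_le_of_le_ofReal zero_le_one (by simp)
  have hsupp : Function.support f = U := by
    ext y
    have h := Metric.mem_iff_infEDist_zero_of_closed (x := y) hU.isClosed_compl
    simp only [Function.mem_support, hf, ne_eq, ENNReal.toReal_eq_zero_iff, hne y, or_false]
    rw [← not_iff_not, not_not, ← mem_compl_iff, h]
    simp only [min_eq_iff, one_ne_zero, false_and, false_or]
    exact ⟨fun h => h.1, fun h => ⟨h, h ▸ zero_le⟩⟩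
  have heq : {p : S × A | 0 < κ p U} = (fun p : S × A => (∫ y, f y ∂(κ p)) / q p) ⁻¹' {0}ᶜ := by
    ext p
    have : IsFiniteMeasure (κ p) := ⟨by rw [hκ_mass]; exact ENNReal.ofReal_lt_top⟩
    have hint : Integrable f (κ p) :=
      Integrable.of_bound hfc.measurable.aestronglyMeasurable 1 (Filter.Eventually.of_forall hf1)
    have hpos := integral_pos_iff_support_of_nonneg (μ := κ p) hf0 hint
    rw [hsupp] at hpos
    have hnn : 0 ≤ ∫ y, f y ∂(κ p) := integral_nonneg hf0
    simp only [mem_ofPred_eq, mem_preimage, mem_compl_iff, mem_singleton_iff, div_eq_zero_iff,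
      not_or]
    rw [← hpos]
    constructor
    · intro h
      refine ⟨h.ne', fun hq => ?_⟩
      have h2 : κ p U ≤ κ p univ := measure_mono (subset_univ _)
      rw [hκ_mass, hq, ENNReal.ofReal_zero] at h2
      exact absurd (hpos.1 h) (not_lt.2 h2)
    · rintro ⟨h, -⟩
      exact lt_of_le_of_ne hnn (Ne.symm h)
  rw [heq]
  exact isOpen_compl_singleton.preimage (hκ_cont f hfc ⟨1, hf1⟩)

/-- Key claim in the proof of Theorem 4.1: for every state `x` outside `W = ⋃ j, W j`,
the infimum over actions of `κ(x,a)(W) + c(x,a)` is zero, and it is attained. -/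
theorem inf_eq_zero_and_attained_outside_W
    {S A : Type*}
    [TopologicalSpace S] [MeasurableSpace S] [BorelSpace S]
    [TopologicalSpace.MetrizableSpace S]
    [TopologicalSpace A] [MeasurableSpace A] [BorelSpace A]
    [TopologicalSpace.MetrizableSpace A] [CompactSpace A] [Nonempty A]
    (q : S × A → ℝ) (hq_cont : Continuous q) (hq_nonneg : ∀ p, 0 ≤ q p)
    (κ : Kernel (S × A) S)
    (hκ_mass : ∀ p, κ p Set.univ = ENNReal.ofReal (q p))
    (hκ_cont : ∀ f : S → ℝ, Continuous f → (∃ C, ∀ y, |f y| ≤ C) →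
      Continuous (fun p : S × A => (∫ y, f y ∂(κ p)) / q p))
    (c : S × A → ℝ≥0∞) (hc : LowerSemicontinuous c)
    (W : ℕ → Set S)
    (hW0 : W 0 = {x : S | ∀ a : A, 0 < c (x, a)})
    (hWsucc : ∀ j : ℕ,
      W (j + 1) = {x : S | ∀ a : A, 0 < κ (x, a) (⋃ i ≤ j, W i) + c (x, a)}) :
    ∀ x : S, x ∉ (⋃ j, W j) →
      (⨅ a : A, (κ (x, a) (⋃ j, W j) + c (x, a))) = 0 ∧
      ∃ a : A, κ (x, a) (⋃ j, W j) = 0 ∧ c (x, a) = 0 := by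
  have hcopen : IsOpen {p : S × A | 0 < c p} := hc.isOpen_preimage 0
  have hset : ∀ U : Set S, IsOpen U → IsOpen {p : S × A | 0 < κ p U + c p} := by
    intro U hU
    have : {p : S × A | 0 < κ p U + c p} = {p | 0 < κ p U} ∪ {p | 0 < c p} := by
      ext p
      simp only [mem_ofPred_eq, mem_union, add_pos_iff]
    rw [this]
    exact (isOpen_kernel_pos q κ hκ_mass hκ_cont U hU).union hcopen
  have hproj : ∀ G : Set (S × A), IsOpen G → IsOpen {x : S | ∀ a : A, (x, a) ∈ G} := by
    intro G hG
    have h := isClosedMap_fst_of_compactSpace (X := S) (Y := A) _ hG.isClosed_compl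
    rw [← isClosed_compl_iff]
    convert h using 1
    ext x
    simp
  have hWopen : ∀ j, IsOpen (W j) := by
    intro j
    induction j using Nat.strong_induction_on with
    | _ j ih =>
      cases j with
      | zero => rw [hW0]; exact hproj _ hcopen
      | succ j =>
        rw [hWsucc]
        exact hproj _ (hset _ (isOpen_biUnion fun i hi => ih i (Nat.lt_succ_of_le hi)))
  intro x hx
  have hUopen : ∀ j, IsOpen (⋃ i ≤ j, W i) := fun j => isOpen_biUnion fun i _ => hWopen i
  have hex : ∃ a : A, κ (x, a) (⋃ j, W j) = 0 ∧ c (x, a) = 0 := by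
    let K : ℕ → Set A := fun j => {a | ¬ 0 < κ (x, a) (⋃ i ≤ j, W i) + c (x, a)}
    have hKc : ∀ j, IsClosed (K j) := fun j =>
      (((hset _ (hUopen j)).preimage (Continuous.prodMk_right x)).isClosed_compl)
    have hne : (⋂ j, K j).Nonempty := by
      refine IsCompact.nonempty_iInter_of_sequence_nonempty_isCompact_isClosed K ?_ ?_
        (hKc 0).isCompact hKc
      · intro j a ha hlt
        refine ha (lt_of_lt_of_le hlt ?_)
        exact add_le_add_left (measure_mono
          (iUnion₂_subset fun i hi => subset_iUnion₂_of_subset i (Nat.le_succ_of_le hi) subset_rfl)) _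
      · intro j
        have h : x ∉ W (j + 1) := fun h => hx (mem_iUnion.2 ⟨_, h⟩)
        rw [hWsucc, mem_ofPred_eq, not_forall] at h
        exact h
    obtain ⟨a, ha⟩ := hne
    have ha' : ∀ j, κ (x, a) (⋃ i ≤ j, W i) = 0 ∧ c (x, a) = 0 := fun j => by
      have h : ¬ 0 < κ (x, a) (⋃ i ≤ j, W i) + c (x, a) := mem_iInter.1 ha j
      simpa using h
    refine ⟨a, measure_iUnion_null fun j => ?_, (ha' 0).2⟩
    have hsub : W j ⊆ ⋃ i ≤ j, W i := fun y hy => mem_iUnion₂.2 ⟨j, le_refl j, hy⟩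
    exact measure_mono_null hsub (ha' j).1
  refine ⟨?_, hex⟩
  obtain ⟨a, h1, h2⟩ := hex
  refine le_antisymm (iInf_le_of_le a ?_) (zero_le)
  simp [h1, h2]
end

section
/- Let S be a metrizable topological space with its Borel σ-algebra, let X be a topological space, and let (μ_x)_{x∈X} be a family of finite Borel measures on S such that μ_x(S) = Q(x) for every x ∈ X, where Q : X → ℝ is continuous and nonnegative; assume that for every bounded continuous f : S → ℝ the map x ↦ (∫_S f dμ_x) / Q(x) is continuous on X, with the convention 0/0 := 0. Then for every lower semicontinuous function g : S → [0,∞], the map x ↦ ∫_S g dμ_x (lower Lebesgue integral, with values in [0,∞]) is lower semicontinuous on X. -/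
open MeasureTheory
open scoped ENNReal

/-- Abstract form of Lemma A.2(b): under the weak-continuity condition (continuity of the
normalized integrals of all bounded continuous functions), the map
`x ↦ ∫⁻ g dμ x` is lower semicontinuous for every lower semicontinuous `g : S → [0,∞]`. -/
theorem lowerSemicontinuous_lintegral_of_weakly_continuous
    {S X : Type*}
    [TopologicalSpace S] [MeasurableSpace S] [BorelSpace S]
    [TopologicalSpace.MetrizableSpace S] [TopologicalSpace X]
    (μ : X → Measure S) (Q : X → ℝ) (hQ : Continuous Q) (hQ0 : ∀ x, 0 ≤ Q x)
    (hmass : ∀ x, μ x Set.univ = ENNReal.ofReal (Q x))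
    (hcont : ∀ f : S → ℝ, Continuous f → (∃ C, ∀ y, |f y| ≤ C) →
      Continuous (fun x => (∫ y, f y ∂(μ x)) / Q x)) :
    ∀ g : S → ℝ≥0∞, LowerSemicontinuous g →
      LowerSemicontinuous (fun x => ∫⁻ y, g y ∂(μ x)) := by
  intro g hg
  letI : MetricSpace S := TopologicalSpace.metrizableSpaceMetric S
  have hfin : ∀ x, IsFiniteMeasure (μ x) := fun x => ⟨by rw [hmass]; exact ENNReal.ofReal_lt_top⟩
  have hint : ∀ f : S → ℝ, Continuous f → (∃ C, ∀ y, |f y| ≤ C) →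
      Continuous (fun x => ∫ y, f y ∂(μ x)) := by
    intro f hf hC
    have h := (hcont f hf hC).mul hQ
    refine h.congr fun x => ?_
    by_cases hx : Q x = 0
    · have : μ x = 0 := by
        rw [← Measure.measure_univ_eq_zero, hmass, hx, ENNReal.ofReal_zero]
      simp [this]
    · exact div_mul_cancel₀ _ hx
  let F : ℕ → S → ℝ≥0∞ := fun n y => min (n : ℝ≥0∞) (⨅ z, g z + n * edist y z)
  have hFc : ∀ n, Continuous (F n) := by
    intro n
    refine continuous_const.min ?_
    refine continuous_of_le_add_edist n (ENNReal.natCast_ne_top n) fun x y => ?_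
    rw [ENNReal.iInf_add]
    refine le_iInf fun z => (iInf_le _ z).trans ?_
    rw [add_assoc, ← mul_add]
    gcongr
    rw [add_comm]
    exact edist_triangle x y z
  have hFn : ∀ n y, F n y ≤ n := fun n y => min_le_left _ _
  have hFt : ∀ n y, F n y ≠ ⊤ := fun n y => ne_top_of_le_ne_top (ENNReal.natCast_ne_top n) (hFn n y)
  have hmono : Monotone F := by
    intro m n hmn y
    have : (m : ℝ≥0∞) ≤ n := by exact_mod_cast hmn
    exact min_le_min this (iInf_mono fun z => by gcongr)
  have hsup : ∀ y, ⨆ n, F n y = g y := by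
    intro y
    apply le_antisymm
    · refine iSup_le fun n => (min_le_right _ _).trans ((iInf_le _ y).trans ?_)
      simp
    · refine le_of_forall_lt_imp_le_of_dense fun c hc => ?_
      obtain ⟨ε, hε, hb⟩ := EMetric.mem_nhds_iff.1 (hg y c hc)
      have hct : c ≠ ⊤ := hc.ne_top
      obtain ⟨n, hn⟩ := ENNReal.exists_nat_gt hct
      obtain ⟨m, hm⟩ := ENNReal.exists_nat_mul_gt hε.ne' hct
      refine le_iSup_of_le (max n m) (le_min ?_ (le_iInf fun z => ?_))
      · exact hn.le.trans (by exact_mod_cast le_max_left n m)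
      · by_cases hz : edist z y < ε
        · exact (hb hz : c < g z).le.trans le_self_add
        · rw [not_lt, edist_comm] at hz
          refine hm.le.trans (le_trans ?_ le_add_self)
          have : (m : ℝ≥0∞) ≤ ((max n m : ℕ) : ℝ≥0∞) := by exact_mod_cast le_max_right n m
          gcongr
  have key : ∀ x, ∫⁻ y, g y ∂(μ x) = ⨆ n, ∫⁻ y, F n y ∂(μ x) := by
    intro x
    rw [← lintegral_iSup (fun n => (hFc n).measurable) hmono]
    simp only [hsup]
  simp only [key]
  refine lowerSemicontinuous_iSup fun n => Continuous.lowerSemicontinuous ?_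
  have hc : Continuous (fun y => (F n y).toReal) :=
    ENNReal.continuousOn_toReal.comp_continuous (hFc n) (hFt n)
  have hbd : ∀ y, |(F n y).toReal| ≤ n := by
    intro y
    rw [abs_of_nonneg ENNReal.toReal_nonneg]
    exact ENNReal.toReal_le_of_le_ofReal (Nat.cast_nonneg n) (by simpa using hFn n y)
  refine (ENNReal.continuous_ofReal.comp (hint _ hc ⟨n, hbd⟩)).congr fun x => ?_
  have hI : Integrable (fun y => (F n y).toReal) (μ x) :=
    Integrable.of_bound hc.measurable.aestronglyMeasurable n
      (Filter.Eventually.of_forall hbd)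
  simp only [Function.comp]
  rw [ofReal_integral_eq_lintegral_ofReal hI
    (Filter.Eventually.of_forall fun y => ENNReal.toReal_nonneg)]
  simp only [ENNReal.ofReal_toReal (hFt n _)]
end
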